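/- Let A be the presented algebra of a triangular datum over a field k. Then A admits a unique bialgebra structure (compatible with its algebra structure) whose comultiplication and counit satisfy Δ(x^r_{ij}) = Σ_{u : (i,u) ∈ P_r and (u,j) ∈ P_r} x^r_{iu} ⊗ x^r_{uj} and ε(x^r_{ij}) = δ_{ij}, and with this structure A is a Hopf algebra whose antipode S is the unique anti-algebra endomorphism of A with S(x^r_{ij}) = x^{r+1}_{ji} (read as 0 if (j,i) ∉ P_{r+1}). -/

import Mathlib

open TensorProduct

universe u v

/-- A *triangular datum*: an index set `R ⊆ ℤ` (all of `ℤ` or a ray `{r | d ≤ r}` with `d ≤ 0`),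
a partially ordered set `I`, and for each `r ∈ R` a reflexive transitive relation `P r` on `I`
subject to the triangularity, local finiteness/chain and flip conditions. -/
structure TriangularDatum (I : Type u) [PartialOrder I] where
  R : Set ℤ
  hR : R = Set.univ ∨ ∃ d : ℤ, d ≤ 0 ∧ R = {r : ℤ | d ≤ r}
  P : ℤ → I → I → Prop
  refl : ∀ r ∈ R, ∀ i : I, P r i i
  trans : ∀ r ∈ R, ∀ i j l : I, P r i j → P r j l → P r i l
  even_lt : ∀ r ∈ R, Even r → ∀ i j : I, P r i j → ¬ (P r i j ∧ P r j i) → i < j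
  odd_lt : ∀ r ∈ R, Odd r → ∀ i j : I, P r i j → ¬ (P r i j ∧ P r j i) → j < i
  row_finite : ∀ r ∈ R, ∀ i : I, {u : I | P r i u}.Finite
  col_finite : ∀ r ∈ R, ∀ i : I, {u : I | P r u i}.Finite
  row_chain : ∀ r ∈ R, ∀ i : I, IsChain (· ≤ ·) {u : I | P r i u}
  col_chain : ∀ r ∈ R, ∀ i : I, IsChain (· ≤ ·) {u : I | P r u i}
  flip : ∀ r ∈ R, ∀ i j : I, P (r + 1) j i → P r i j

namespace TriangularDatum

variable {I : Type u} [PartialOrder I]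

/-- The relation `i ∼_r j`, i.e. `(i,j) ∈ P_r` and `(j,i) ∈ P_r`. -/
def sim (D : TriangularDatum I) (r : ℤ) (i j : I) : Prop := D.P r i j ∧ D.P r j i

/-- The size hypothesis: every equivalence class of `⋂_{r ∈ R} ∼_r` has at least two
elements. -/
def SizeHyp (D : TriangularDatum I) : Prop :=
  ∀ i : I, ∃ j : I, j ≠ i ∧ ∀ r ∈ D.R, D.sim r i j

/-- The generators `x^r_{ij}`, `r ∈ R`, `(i,j) ∈ P_r`. -/
def Gen (D : TriangularDatum I) : Type u :=
  {p : ℤ × I × I // p.1 ∈ D.R ∧ D.P p.1 p.2.1 p.2.2}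

variable (k : Type u) [Field k]

open Classical in
/-- The element of the free algebra corresponding to the symbol `x^r_{ij}`, read as `0` if
`(i,j) ∉ P_r` (or `r ∉ R`). -/
noncomputable def X (D : TriangularDatum I) (r : ℤ) (i j : I) : FreeAlgebra k D.Gen :=
  if h : r ∈ D.R ∧ D.P r i j then FreeAlgebra.ι k ⟨(r, i, j), h⟩ else 0

open Classical in
/-- The defining relations of the presented algebra: for all `r ∈ R` and `i, j ∈ I`,
`Σ_u x^r_{iu}·x^{r+1}_{ju} = δ_{ij}` and `Σ_u x^{r+1}_{ui}·x^r_{uj} = δ_{ij}`. -/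
inductive PresRel (D : TriangularDatum I) :
    FreeAlgebra k D.Gen → FreeAlgebra k D.Gen → Prop
  | row (r : ℤ) (hr : r ∈ D.R) (i j : I) :
      PresRel D (∑ᶠ u : I, X k D r i u * X k D (r + 1) j u) (if i = j then 1 else 0)
  | col (r : ℤ) (hr : r ∈ D.R) (i j : I) :
      PresRel D (∑ᶠ u : I, X k D (r + 1) u i * X k D r u j) (if i = j then 1 else 0)

/-- The presented algebra of a triangular datum: the quotient of the free algebra on the
generators `x^r_{ij}` by the two-sided ideal generated by the defining relations. -/
abbrev PresentedAlgebra (D : TriangularDatum I) : Type _ := RingQuot (PresRel k D)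

/-- The image of the generator `g` in the presented algebra. -/
noncomputable def xgen (D : TriangularDatum I) (g : D.Gen) : PresentedAlgebra k D :=
  RingQuot.mkAlgHom k (PresRel k D) (FreeAlgebra.ι k g)

/-- The image of the symbol `x^r_{ij}` in the presented algebra (`0` if `(i,j) ∉ P_r`). -/
noncomputable def xelt (D : TriangularDatum I) (r : ℤ) (i j : I) : PresentedAlgebra k D :=
  RingQuot.mkAlgHom k (PresRel k D) (X k D r i j)

end TriangularDatum

open TriangularDatum

variable {I : Type u} [PartialOrder I] (k : Type u) [Field k]

open Classical in
/-- The pair `(Δ, ε)` is a bialgebra structure on the `k`-algebra `A` (compatible with the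
given algebra structure): `Δ` is coassociative with counit `ε`, and both are algebra
homomorphisms. -/
def IsBialgebraStructure (A : Type u) [Ring A] [Algebra k A]
    (Δ : A →ₗ[k] A ⊗[k] A) (ε : A →ₗ[k] k) : Prop :=
  ((TensorProduct.assoc k A A A).toLinearMap ∘ₗ Δ.rTensor A ∘ₗ Δ = Δ.lTensor A ∘ₗ Δ) ∧
  ((TensorProduct.lid k A).toLinearMap ∘ₗ ε.rTensor A ∘ₗ Δ = LinearMap.id) ∧
  ((TensorProduct.rid k A).toLinearMap ∘ₗ ε.lTensor A ∘ₗ Δ = LinearMap.id) ∧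
  (Δ 1 = 1) ∧ (∀ a b : A, Δ (a * b) = Δ a * Δ b) ∧
  (ε 1 = 1) ∧ (∀ a b : A, ε (a * b) = ε a * ε b)

open Classical in
/-- The comultiplication and counit take the prescribed values on the generators:
`Δ(x^r_{ij}) = Σ_u x^r_{iu} ⊗ x^r_{uj}` and `ε(x^r_{ij}) = δ_{ij}`. -/
def GenFormulas (D : TriangularDatum I)
    (Δ : PresentedAlgebra k D →ₗ[k] PresentedAlgebra k D ⊗[k] PresentedAlgebra k D)
    (ε : PresentedAlgebra k D →ₗ[k] k) : Prop :=
  (∀ r ∈ D.R, ∀ i j : I,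
      Δ (xelt k D r i j) = ∑ᶠ u : I, xelt k D r i u ⊗ₜ[k] xelt k D r u j) ∧
  (∀ r ∈ D.R, ∀ i j : I, ε (xelt k D r i j) = if i = j then (1 : k) else 0)

/-- `S` is an anti-algebra endomorphism. -/
def IsAntiAlgEnd (A : Type u) [Ring A] [Algebra k A] (S : A →ₗ[k] A) : Prop :=
  S 1 = 1 ∧ ∀ a b : A, S (a * b) = S b * S a

/-- `S` takes the prescribed values on generators: `S(x^r_{ij}) = x^{r+1}_{ji}` (read as `0`
if `(j,i) ∉ P_{r+1}`). -/
def AntipodeFormulas (D : TriangularDatum I)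
    (S : PresentedAlgebra k D →ₗ[k] PresentedAlgebra k D) : Prop :=
  ∀ r ∈ D.R, ∀ i j : I, S (xelt k D r i j) = xelt k D (r + 1) j i

/-- `S` is an antipode for the bialgebra structure `(Δ, ε)` on `A`. -/
def IsAntipode (A : Type u) [Ring A] [Algebra k A]
    (Δ : A →ₗ[k] A ⊗[k] A) (ε : A →ₗ[k] k) (S : A →ₗ[k] A) : Prop :=
  (LinearMap.mul' k A ∘ₗ S.rTensor A ∘ₗ Δ = Algebra.linearMap k A ∘ₗ ε) ∧
  (LinearMap.mul' k A ∘ₗ S.lTensor A ∘ₗ Δ = Algebra.linearMap k A ∘ₗ ε)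

namespace TriangularDatum

section Helpers

variable (D : TriangularDatum I)

theorem succ_mem_R {r : ℤ} (hr : r ∈ D.R) : r + 1 ∈ D.R := by
  rcases D.hR with h | ⟨d, _, h⟩
  · rw [h]; trivial
  · rw [h] at hr ⊢
    simp only [Set.mem_ofPred_eq] at hr ⊢
    omega

theorem X_zero {r : ℤ} {i j : I} (h : ¬ D.P r i j) : X k D r i j = 0 := by
  unfold X
  rw [dif_neg]
  exact fun h' => h h'.2

theorem xelt_zero {r : ℤ} {i j : I} (h : ¬ D.P r i j) : xelt k D r i j = 0 := by
  unfold xelt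
  rw [X_zero k D h, map_zero]

theorem mapX_row_finite {r : ℤ} (hr : r ∈ D.R) (i j : I) :
    (Function.support fun u : I => X k D r i u * X k D (r + 1) j u).Finite := by
  refine (D.row_finite r hr i).subset fun u hu => ?_
  by_contra h
  exact hu (by simp [X_zero k D (show ¬ D.P r i u from h)])

theorem mapX_col_finite {r : ℤ} (hr : r ∈ D.R) (i j : I) :
    (Function.support fun u : I => X k D (r + 1) u i * X k D r u j).Finite := by
  refine (D.col_finite r hr j).subset fun u hu => ?_
  by_contra h
  exact hu (by simp [X_zero k D (show ¬ D.P r u j from h)])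

open Classical in
theorem xelt_row {r : ℤ} (hr : r ∈ D.R) (i j : I) :
    ∑ᶠ u : I, xelt k D r i u * xelt k D (r + 1) j u = if i = j then 1 else 0 := by
  have h := RingQuot.mkAlgHom_rel k (PresRel.row (k := k) (D := D) r hr i j)
  rw [map_finsum _ (mapX_row_finite k D hr i j)] at h
  simp only [map_mul] at h
  refine h.trans ?_
  split_ifs <;> simp

open Classical in
theorem xelt_col {r : ℤ} (hr : r ∈ D.R) (i j : I) :
    ∑ᶠ u : I, xelt k D (r + 1) u i * xelt k D r u j = if i = j then 1 else 0 := by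
  have h := RingQuot.mkAlgHom_rel k (PresRel.col (k := k) (D := D) r hr i j)
  rw [map_finsum _ (mapX_col_finite k D hr i j)] at h
  simp only [map_mul] at h
  refine h.trans ?_
  split_ifs <;> simp

open Classical in
theorem xelt_row_sum {r : ℤ} (hr : r ∈ D.R) (i j : I) (F : Finset I)
    (hF : ∀ u, D.P r i u → u ∈ F) :
    ∑ u ∈ F, xelt k D r i u * xelt k D (r + 1) j u = if i = j then 1 else 0 := by
  rw [← xelt_row k D hr i j, finsum_eq_sum_of_support_subset]
  intro u hu
  apply hF
  by_contra h
  exact hu (by simp [xelt_zero k D h])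

open Classical in
theorem xelt_col_sum {r : ℤ} (hr : r ∈ D.R) (i j : I) (F : Finset I)
    (hF : ∀ u, D.P r u j → u ∈ F) :
    ∑ u ∈ F, xelt k D (r + 1) u i * xelt k D r u j = if i = j then 1 else 0 := by
  rw [← xelt_col k D hr i j, finsum_eq_sum_of_support_subset]
  intro u hu
  apply hF
  by_contra h
  exact hu (by simp [xelt_zero k D h])

theorem induct {C : PresentedAlgebra k D → Prop}
    (halg : ∀ c : k, C (algebraMap k _ c))
    (hx : ∀ r ∈ D.R, ∀ i j, C (xelt k D r i j))
    (hmul : ∀ a b, C a → C b → C (a * b)) (hadd : ∀ a b, C a → C b → C (a + b)) (a) : C a := by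
  obtain ⟨a, rfl⟩ := RingQuot.mkAlgHom_surjective k (PresRel k D) a
  induction a using FreeAlgebra.induction with
  | grade0 c => rw [AlgHom.commutes]; exact halg c
  | grade1 g =>
    obtain ⟨⟨r, i, j⟩, h⟩ := g
    have := hx r h.1 i j
    unfold xelt X at this
    rwa [dif_pos h] at this
  | mul a b ha hb => rw [map_mul]; exact hmul _ _ ha hb
  | add a b ha hb => rw [map_add]; exact hadd _ _ ha hb

theorem hom_ext {B : Type*} [Semiring B] [Algebra k B] (f g : PresentedAlgebra k D →ₐ[k] B)
    (h : ∀ r ∈ D.R, ∀ i j, f (xelt k D r i j) = g (xelt k D r i j)) : f = g := by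
  ext1
  ext ⟨⟨r, i, j⟩, hh⟩
  have := h r hh.1 i j
  unfold xelt X at this
  rw [dif_pos hh] at this
  exact this

open Classical in
theorem exists_hom {B : Type*} [Semiring B] [Algebra k B] (f : ℤ → I → I → B)
    (h0 : ∀ r ∈ D.R, ∀ i j, ¬ D.P r i j → f r i j = 0)
    (hrow : ∀ r ∈ D.R, ∀ i j, ∑ᶠ u, f r i u * f (r + 1) j u = if i = j then 1 else 0)
    (hcol : ∀ r ∈ D.R, ∀ i j, ∑ᶠ u, f (r + 1) u i * f r u j = if i = j then 1 else 0) :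
    ∃ φ : PresentedAlgebra k D →ₐ[k] B, ∀ r ∈ D.R, ∀ i j, φ (xelt k D r i j) = f r i j := by
  let ψ : FreeAlgebra k D.Gen →ₐ[k] B := FreeAlgebra.lift k fun g => f g.1.1 g.1.2.1 g.1.2.2
  have hψ : ∀ r ∈ D.R, ∀ i j, ψ (X k D r i j) = f r i j := by
    intro r hr i j
    by_cases h : D.P r i j
    · unfold X
      rw [dif_pos ⟨hr, h⟩]
      exact FreeAlgebra.lift_ι_apply (R := k) (fun g : D.Gen => f g.1.1 g.1.2.1 g.1.2.2) _
    · rw [X_zero k D h, map_zero, h0 r hr i j h]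
  have hrel : ∀ ⦃x y⦄, PresRel k D x y → ψ x = ψ y := by
    intro x y hxy
    cases hxy with
    | row r hr i j =>
      rw [map_finsum _ (mapX_row_finite k D hr i j)]
      simp only [map_mul, hψ r hr, hψ (r + 1) (D.succ_mem_R hr), hrow r hr]
      split_ifs <;> simp
    | col r hr i j =>
      rw [map_finsum _ (mapX_col_finite k D hr i j)]
      simp only [map_mul, hψ r hr, hψ (r + 1) (D.succ_mem_R hr), hcol r hr]
      split_ifs <;> simp
  refine ⟨RingQuot.liftAlgHom k ⟨ψ, hrel⟩, fun r hr i j => ?_⟩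
  unfold xelt
  rw [RingQuot.liftAlgHom_mkAlgHom_apply, hψ r hr]

/-- The comultiplication on generators. -/
noncomputable def cm (r : ℤ) (i j : I) : PresentedAlgebra k D ⊗[k] PresentedAlgebra k D :=
  ∑ᶠ u : I, xelt k D r i u ⊗ₜ[k] xelt k D r u j

theorem cm_eq_row (r : ℤ) (i j : I) (F : Finset I) (hF : ∀ u, D.P r i u → u ∈ F) :
    cm k D r i j = ∑ u ∈ F, xelt k D r i u ⊗ₜ[k] xelt k D r u j := by
  unfold cm
  rw [finsum_eq_sum_of_support_subset]
  intro u hu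
  apply hF
  by_contra h
  exact hu (by simp [xelt_zero k D h])

theorem cm_eq_col (r : ℤ) (i j : I) (F : Finset I) (hF : ∀ u, D.P r u j → u ∈ F) :
    cm k D r i j = ∑ u ∈ F, xelt k D r i u ⊗ₜ[k] xelt k D r u j := by
  unfold cm
  rw [finsum_eq_sum_of_support_subset]
  intro u hu
  apply hF
  by_contra h
  exact hu (by simp [xelt_zero k D h])

theorem cm_zero {r : ℤ} (hr : r ∈ D.R) (i j : I) (h : ¬ D.P r i j) : cm k D r i j = 0 := by
  unfold cm
  apply finsum_eq_zero_of_forall_eq_zero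
  intro u
  by_cases h1 : D.P r i u
  · rw [xelt_zero k D (fun h2 => h (D.trans r hr _ _ _ h1 h2)), tmul_zero]
  · rw [xelt_zero k D h1, zero_tmul]

open Classical in
theorem cm_row {r : ℤ} (hr : r ∈ D.R) (i j : I) :
    ∑ᶠ u, cm k D r i u * cm k D (r + 1) j u = if i = j then 1 else 0 := by
  have hr1 := D.succ_mem_R hr
  obtain ⟨F, hF⟩ := (D.row_finite r hr i).exists_finset
  obtain ⟨G, hG⟩ := (D.row_finite (r + 1) hr1 j).exists_finset
  simp only [Set.mem_ofPred_eq] at hF hG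
  rw [finsum_eq_sum_of_support_subset (s := F)]
  swap
  · intro u hu
    rw [Finset.mem_coe, hF]
    by_contra h
    exact hu (by simp [cm_zero k D hr _ _ h])
  simp only [fun u => cm_eq_row k D r i u F fun u => (hF u).2,
    fun u => cm_eq_row k D (r + 1) j u G fun u => (hG u).2,
    Finset.sum_mul_sum, Algebra.TensorProduct.tmul_mul_tmul]
  rw [Finset.sum_comm]
  have : ∀ v ∈ F, ∑ u ∈ F, ∑ w ∈ G, (xelt k D r i v * xelt k D (r + 1) j w) ⊗ₜ[k]
      (xelt k D r v u * xelt k D (r + 1) w u) =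
      (xelt k D r i v * xelt k D (r + 1) j v) ⊗ₜ[k] 1 := by
    intro v hv
    rw [Finset.sum_comm]
    simp only [← tmul_sum]
    simp only [fun w => xelt_row_sum k D hr v w F
      fun u hu => (hF u).2 (D.trans r hr _ _ _ ((hF v).1 hv) hu)]
    by_cases hvG : v ∈ G
    · rw [Finset.sum_eq_single v]
      · simp
      · intro w _ hw
        rw [if_neg (Ne.symm hw), tmul_zero]
      · exact fun h => absurd hvG h
    · rw [xelt_zero k D (fun h => hvG ((hG v).2 h)), mul_zero, zero_tmul]
      apply Finset.sum_eq_zero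
      intro w hw
      rw [if_neg, tmul_zero]
      rintro rfl
      exact hvG hw
  rw [Finset.sum_congr rfl this, ← sum_tmul, xelt_row_sum k D hr i j F fun u => (hF u).2]
  split_ifs
  · rfl
  · rw [zero_tmul]

open Classical in
theorem cm_col {r : ℤ} (hr : r ∈ D.R) (i j : I) :
    ∑ᶠ u, cm k D (r + 1) u i * cm k D r u j = if i = j then 1 else 0 := by
  have hr1 := D.succ_mem_R hr
  obtain ⟨F, hF⟩ := (D.col_finite r hr j).exists_finset
  obtain ⟨G, hG⟩ := (D.col_finite (r + 1) hr1 i).exists_finset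
  simp only [Set.mem_ofPred_eq] at hF hG
  rw [finsum_eq_sum_of_support_subset (s := F)]
  swap
  · intro u hu
    rw [Finset.mem_coe, hF]
    by_contra h
    exact hu (by simp [cm_zero k D hr _ _ h])
  simp only [fun u => cm_eq_col k D r u j F fun u => (hF u).2,
    fun u => cm_eq_col k D (r + 1) u i G fun u => (hG u).2,
    Finset.sum_mul_sum, Algebra.TensorProduct.tmul_mul_tmul]
  have : ∀ v ∈ F, ∑ u ∈ F, ∑ w ∈ G, (xelt k D (r + 1) u w * xelt k D r u v) ⊗ₜ[k]
      (xelt k D (r + 1) w i * xelt k D r v j) =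
      1 ⊗ₜ[k] (xelt k D (r + 1) v i * xelt k D r v j) := by
    intro v hv
    rw [Finset.sum_comm]
    simp only [← sum_tmul]
    simp only [fun w => xelt_col_sum k D hr w v F
      fun u hu => (hF u).2 (D.trans r hr _ _ _ hu ((hF v).1 hv))]
    by_cases hvG : v ∈ G
    · rw [Finset.sum_eq_single v]
      · simp
      · intro w _ hw
        rw [if_neg hw, zero_tmul]
      · exact fun h => absurd hvG h
    · rw [xelt_zero k D (fun h => hvG ((hG v).2 h)), zero_mul, tmul_zero]
      apply Finset.sum_eq_zero
      intro w hw
      rw [if_neg, zero_tmul]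
      rintro rfl
      exact hvG hw
  have h2 : ∀ u ∈ F, ∑ w ∈ G, ∑ v ∈ F, (xelt k D (r + 1) u w * xelt k D r u v) ⊗ₜ[k]
      (xelt k D (r + 1) w i * xelt k D r v j) = ∑ v ∈ F, ∑ w ∈ G,
      (xelt k D (r + 1) u w * xelt k D r u v) ⊗ₜ[k]
      (xelt k D (r + 1) w i * xelt k D r v j) := fun u _ => Finset.sum_comm
  rw [Finset.sum_congr rfl h2, Finset.sum_comm, Finset.sum_congr rfl this, ← tmul_sum,
    xelt_col_sum k D hr i j F fun u => (hF u).2]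
  split_ifs
  · rfl
  · rw [tmul_zero]

theorem exists_comul : ∃ φ : PresentedAlgebra k D →ₐ[k]
    PresentedAlgebra k D ⊗[k] PresentedAlgebra k D,
    ∀ r ∈ D.R, ∀ i j, φ (xelt k D r i j) = cm k D r i j :=
  exists_hom k D (cm k D) (fun _ hr i j h => cm_zero k D hr i j h)
    (fun _ hr i j => cm_row k D hr i j) (fun _ hr i j => cm_col k D hr i j)

open Classical in
theorem exists_counit : ∃ φ : PresentedAlgebra k D →ₐ[k] k,
    ∀ r ∈ D.R, ∀ i j, φ (xelt k D r i j) = if i = j then 1 else 0 := by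
  refine exists_hom k D (fun _ i j => if i = j then 1 else 0) ?_ ?_ ?_
  · intro r hr i j h
    rw [if_neg]
    rintro rfl
    exact h (D.refl r hr i)
  · intro r hr i j
    rw [finsum_eq_single _ i (fun u hu => by simp [Ne.symm hu])]
    simp [eq_comm]
  · intro r hr i j
    rw [finsum_eq_single _ i (fun u hu => by simp [hu])]
    simp

open Classical in
theorem exists_antipode : ∃ φ : PresentedAlgebra k D →ₐ[k] (PresentedAlgebra k D)ᵐᵒᵖ,
    ∀ r ∈ D.R, ∀ i j, φ (xelt k D r i j) = MulOpposite.op (xelt k D (r + 1) j i) := by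
  refine exists_hom k D (fun r i j => MulOpposite.op (xelt k D (r + 1) j i)) ?_ ?_ ?_
  · intro r hr i j h
    rw [xelt_zero k D (fun h' => h (D.flip r hr _ _ h')), MulOpposite.op_zero]
  · intro r hr i j
    have hr1 := D.succ_mem_R hr
    obtain ⟨F, hF⟩ := (D.col_finite (r + 1) hr1 i).exists_finset
    simp only [Set.mem_ofPred_eq] at hF
    rw [finsum_eq_sum_of_support_subset (s := F)]
    · simp only [← MulOpposite.op_mul, ← Finset.op_sum]
      rw [xelt_col_sum k D hr1 j i F fun u => (hF u).2]
      simp only [eq_comm]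
      split_ifs <;> rfl
    · intro u hu
      rw [Finset.mem_coe, hF]
      by_contra h
      exact hu (by simp [xelt_zero k D h])
  · intro r hr i j
    have hr1 := D.succ_mem_R hr
    obtain ⟨F, hF⟩ := (D.row_finite (r + 1) hr1 j).exists_finset
    simp only [Set.mem_ofPred_eq] at hF
    rw [finsum_eq_sum_of_support_subset (s := F)]
    · simp only [← MulOpposite.op_mul, ← Finset.op_sum]
      rw [xelt_row_sum k D hr1 j i F fun u => (hF u).2]
      simp only [eq_comm]
      split_ifs <;> rfl
    · intro u hu
      rw [Finset.mem_coe, hF]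
      by_contra h
      exact hu (by simp [xelt_zero k D h])

theorem coassoc (φ : PresentedAlgebra k D →ₐ[k] PresentedAlgebra k D ⊗[k] PresentedAlgebra k D)
    (hφ : ∀ r ∈ D.R, ∀ i j, φ (xelt k D r i j) = cm k D r i j) :
    (TensorProduct.assoc k _ _ _).toLinearMap ∘ₗ φ.toLinearMap.rTensor _ ∘ₗ φ.toLinearMap
      = φ.toLinearMap.lTensor _ ∘ₗ φ.toLinearMap := by
  have key : (((Algebra.TensorProduct.assoc k k k _ _ _).toAlgHom.comp
      (Algebra.TensorProduct.map φ (AlgHom.id k _))).comp φ) =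
      (Algebra.TensorProduct.map (AlgHom.id k _) φ).comp φ := by
    apply hom_ext
    intro r hr i j
    obtain ⟨F, hF⟩ := (D.row_finite r hr i).exists_finset
    simp only [Set.mem_ofPred_eq] at hF
    have hc : ∀ v ∈ F, ∀ l, cm k D r v l = ∑ u ∈ F, xelt k D r v u ⊗ₜ[k] xelt k D r u l :=
      fun v hv l => cm_eq_row k D r v l F
        fun u hu => (hF u).2 (D.trans r hr _ _ _ ((hF v).1 hv) hu)
    have hi : i ∈ F := (hF i).2 (D.refl r hr i)
    simp only [AlgHom.comp_apply, hφ r hr, hc i hi, map_sum, Algebra.TensorProduct.map_tmul,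
      sum_tmul, AlgHom.id_apply]
    rw [Finset.sum_comm]
    refine Finset.sum_congr rfl fun v hv => ?_
    rw [hc v hv, tmul_sum]
    refine Finset.sum_congr rfl fun u hu => ?_
    rfl
  exact congrArg AlgHom.toLinearMap key

open Classical in
theorem counit_left
    (φ : PresentedAlgebra k D →ₐ[k] PresentedAlgebra k D ⊗[k] PresentedAlgebra k D)
    (hφ : ∀ r ∈ D.R, ∀ i j, φ (xelt k D r i j) = cm k D r i j)
    (e : PresentedAlgebra k D →ₐ[k] k)
    (he : ∀ r ∈ D.R, ∀ i j, e (xelt k D r i j) = if i = j then 1 else 0) :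
    (TensorProduct.lid k _).toLinearMap ∘ₗ e.toLinearMap.rTensor _ ∘ₗ φ.toLinearMap
      = LinearMap.id := by
  have key : (((Algebra.TensorProduct.lid k _).toAlgHom.comp
      (Algebra.TensorProduct.map e (AlgHom.id k _))).comp φ) = AlgHom.id k _ := by
    apply hom_ext
    intro r hr i j
    obtain ⟨F, hF⟩ := (D.row_finite r hr i).exists_finset
    simp only [Set.mem_ofPred_eq] at hF
    have hi : i ∈ F := (hF i).2 (D.refl r hr i)
    simp [AlgHom.comp_apply, hφ r hr, cm_eq_row k D r i j F fun u => (hF u).2, map_sum, he r hr,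
      hi]
  exact congrArg AlgHom.toLinearMap key

open Classical in
theorem counit_right
    (φ : PresentedAlgebra k D →ₐ[k] PresentedAlgebra k D ⊗[k] PresentedAlgebra k D)
    (hφ : ∀ r ∈ D.R, ∀ i j, φ (xelt k D r i j) = cm k D r i j)
    (e : PresentedAlgebra k D →ₐ[k] k)
    (he : ∀ r ∈ D.R, ∀ i j, e (xelt k D r i j) = if i = j then 1 else 0) :
    (TensorProduct.rid k _).toLinearMap ∘ₗ e.toLinearMap.lTensor _ ∘ₗ φ.toLinearMap
      = LinearMap.id := by
  have key : (((Algebra.TensorProduct.rid k k _).toAlgHom.comp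
      (Algebra.TensorProduct.map (AlgHom.id k _) e)).comp φ) = AlgHom.id k _ := by
    apply hom_ext
    intro r hr i j
    obtain ⟨F, hF⟩ := (D.col_finite r hr j).exists_finset
    simp only [Set.mem_ofPred_eq] at hF
    have hi : j ∈ F := (hF j).2 (D.refl r hr j)
    simp [AlgHom.comp_apply, hφ r hr, cm_eq_col k D r i j F fun u => (hF u).2, map_sum, he r hr,
      hi]
  exact congrArg AlgHom.toLinearMap key

end Helpers

section Anti

variable {k} {A : Type u} [Ring A] [Algebra k A]

theorem anti_left (S : A →ₗ[k] A) (hS : ∀ a b, S (a * b) = S b * S a) (t : A ⊗[k] A) (c : k)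
    (ht : LinearMap.mul' k A (S.rTensor A t) = algebraMap k A c) (s : A ⊗[k] A) :
    LinearMap.mul' k A (S.rTensor A (t * s)) = c • LinearMap.mul' k A (S.rTensor A s) := by
  induction s with
  | zero => simp
  | add x y hx hy => rw [mul_add, map_add, map_add, hx, hy, map_add, map_add, smul_add]
  | tmul x y =>
    have h : ∀ t : A ⊗[k] A, LinearMap.mul' k A (S.rTensor A (t * x ⊗ₜ[k] y)) =
        S x * LinearMap.mul' k A (S.rTensor A t) * y := by
      intro t
      induction t with
      | zero => simp
      | add a b ha hb => rw [add_mul, map_add, map_add, ha, hb, map_add, map_add, mul_add, add_mul]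
      | tmul a b => simp [hS, mul_assoc]
    rw [h, ht, ← Algebra.commutes, mul_assoc, ← Algebra.smul_def]
    simp

theorem anti_right (S : A →ₗ[k] A) (hS : ∀ a b, S (a * b) = S b * S a) (t : A ⊗[k] A) (c : k)
    (ht : LinearMap.mul' k A (S.lTensor A t) = algebraMap k A c) (s : A ⊗[k] A) :
    LinearMap.mul' k A (S.lTensor A (s * t)) = c • LinearMap.mul' k A (S.lTensor A s) := by
  induction s with
  | zero => simp
  | add x y hx hy => rw [add_mul, map_add, map_add, hx, hy, map_add, map_add, smul_add]
  | tmul x y =>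
    have h : ∀ t : A ⊗[k] A, LinearMap.mul' k A (S.lTensor A (x ⊗ₜ[k] y * t)) =
        x * LinearMap.mul' k A (S.lTensor A t) * S y := by
      intro t
      induction t with
      | zero => simp
      | add a b ha hb => rw [mul_add, map_add, map_add, ha, hb, map_add, map_add, mul_add, add_mul]
      | tmul a b => simp [hS, mul_assoc]
    rw [h, ht, ← Algebra.commutes, mul_assoc, ← Algebra.smul_def]
    simp

end Anti

theorem isAntipode_of (D : TriangularDatum I)
    (Δ : PresentedAlgebra k D →ₗ[k] PresentedAlgebra k D ⊗[k] PresentedAlgebra k D)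
    (ε : PresentedAlgebra k D →ₗ[k] k)
    (hb : IsBialgebraStructure k (PresentedAlgebra k D) Δ ε) (hg : GenFormulas k D Δ ε)
    (S : PresentedAlgebra k D →ₗ[k] PresentedAlgebra k D)
    (hS : IsAntiAlgEnd k (PresentedAlgebra k D) S) (hf : AntipodeFormulas k D S) :
    IsAntipode k (PresentedAlgebra k D) Δ ε S := by
  classical
  obtain ⟨-, -, -, hΔ1, hΔm, hε1, hεm⟩ := hb
  obtain ⟨hΔx, hεx⟩ := hg
  obtain ⟨hS1, hSm⟩ := hS
  constructor
  · refine LinearMap.ext fun a => ?_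
    simp only [LinearMap.comp_apply, Algebra.linearMap_apply]
    induction a using induct k D with
    | halg c =>
      rw [Algebra.algebraMap_eq_smul_one]
      simp only [map_smul, hΔ1, hε1, Algebra.TensorProduct.one_def, LinearMap.rTensor_tmul, hS1,
        LinearMap.mul'_apply, mul_one, map_one, Algebra.algebraMap_eq_smul_one, smul_eq_mul]
    | hx r hr i j =>
      obtain ⟨F, hF⟩ := (D.col_finite r hr j).exists_finset
      have := cm_eq_col k D r i j F fun u => (hF u).2
      unfold cm at this
      rw [hΔx r hr, hεx r hr, this]
      simp only [map_sum, LinearMap.rTensor_tmul, hf r hr, LinearMap.mul'_apply]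
      rw [xelt_col_sum k D hr i j F fun u => (hF u).2]
      split_ifs <;> simp
    | hmul a b ha hb =>
      rw [hΔm, anti_left S hSm _ _ ha, hb, hεm, map_mul, Algebra.smul_def]
    | hadd a b ha hb => simp only [map_add, ha, hb]
  · refine LinearMap.ext fun a => ?_
    simp only [LinearMap.comp_apply, Algebra.linearMap_apply]
    induction a using induct k D with
    | halg c =>
      rw [Algebra.algebraMap_eq_smul_one]
      simp only [map_smul, hΔ1, hε1, Algebra.TensorProduct.one_def, LinearMap.lTensor_tmul, hS1,
        LinearMap.mul'_apply, mul_one, map_one, Algebra.algebraMap_eq_smul_one, smul_eq_mul]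
    | hx r hr i j =>
      obtain ⟨F, hF⟩ := (D.row_finite r hr i).exists_finset
      have := cm_eq_row k D r i j F fun u => (hF u).2
      unfold cm at this
      rw [hΔx r hr, hεx r hr, this]
      simp only [map_sum, LinearMap.lTensor_tmul, hf r hr, LinearMap.mul'_apply]
      rw [xelt_row_sum k D hr i j F fun u => (hF u).2]
      split_ifs <;> simp
    | hmul a b ha hb =>
      rw [hΔm, anti_right S hSm _ _ hb, ha, hεm, map_mul, Algebra.smul_def, Algebra.commutes]
    | hadd a b ha hb => simp only [map_add, ha, hb]

end TriangularDatum

/-- the presented algebra of a triangular datum admits a unique bialgebra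
structure (compatible with its algebra structure) satisfying the generator formulas, and
with this structure it is a Hopf algebra whose antipode is the unique anti-algebra
endomorphism with `S(x^r_{ij}) = x^{r+1}_{ji}`. -/
theorem presentedAlgebra_bialgebra_structure_exists_unique_and_hopf
    (D : TriangularDatum I) :
    (∃! ΔE : (PresentedAlgebra k D →ₗ[k] PresentedAlgebra k D ⊗[k] PresentedAlgebra k D) ×
        (PresentedAlgebra k D →ₗ[k] k),
      IsBialgebraStructure k (PresentedAlgebra k D) ΔE.1 ΔE.2 ∧
        GenFormulas k D ΔE.1 ΔE.2) ∧
    (∀ (Δ : PresentedAlgebra k D →ₗ[k] PresentedAlgebra k D ⊗[k] PresentedAlgebra k D)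
        (ε : PresentedAlgebra k D →ₗ[k] k),
      IsBialgebraStructure k (PresentedAlgebra k D) Δ ε → GenFormulas k D Δ ε →
        (∃! S : PresentedAlgebra k D →ₗ[k] PresentedAlgebra k D,
          IsAntiAlgEnd k (PresentedAlgebra k D) S ∧ AntipodeFormulas k D S) ∧
        (∀ S : PresentedAlgebra k D →ₗ[k] PresentedAlgebra k D,
          IsAntiAlgEnd k (PresentedAlgebra k D) S → AntipodeFormulas k D S →
            IsAntipode k (PresentedAlgebra k D) Δ ε S)) := by
  classical
  constructor
  · obtain ⟨φ, hφ⟩ := exists_comul k D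
    obtain ⟨e, he⟩ := exists_counit k D
    refine ⟨(φ.toLinearMap, e.toLinearMap), ⟨⟨coassoc k D φ hφ, counit_left k D φ hφ e he,
      counit_right k D φ hφ e he, map_one φ, map_mul φ, map_one e, map_mul e⟩, ?_, ?_⟩, ?_⟩
    · exact fun r hr i j => hφ r hr i j
    · intro r hr i j
      exact (he r hr i j).trans (by congr)
    · rintro ⟨Δ, ε⟩ ⟨⟨-, -, -, h1, hm, h1', hm'⟩, hg, hg'⟩
      simp only at h1 hm h1' hm' hg hg'
      have e1 : AlgHom.ofLinearMap Δ h1 hm = φ := hom_ext k D _ _ fun r hr i j => by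
        rw [hφ r hr]; exact hg r hr i j
      have e2 : AlgHom.ofLinearMap ε h1' hm' = e := hom_ext k D _ _ fun r hr i j => by
        rw [he r hr]; exact (hg' r hr i j).trans (by congr)
      rw [← e1, ← e2]
      rfl
  · intro Δ ε hb hg
    refine ⟨?_, fun S hS hf => isAntipode_of k D Δ ε hb hg S hS hf⟩
    obtain ⟨φ, hφ⟩ := exists_antipode k D
    refine ⟨(MulOpposite.opLinearEquiv k).symm.toLinearMap ∘ₗ φ.toLinearMap,
      ⟨⟨?_, ?_⟩, ?_⟩, ?_⟩
    · simp
    · intro a b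
      simp
    · intro r hr i j
      simp [hφ r hr]
    · rintro S ⟨⟨h1, hm⟩, hf⟩
      refine LinearMap.ext fun a => ?_
      induction a using induct k D with
      | halg c =>
        rw [Algebra.algebraMap_eq_smul_one, map_smul, map_smul, h1]
        simp
      | hx r hr i j => rw [hf r hr]; simp [hφ r hr]
      | hmul a b ha hb => rw [hm, ha, hb]; simp
      | hadd a b ha hb => rw [map_add, map_add, ha, hb]
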